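/- Let Φ denote the cumulative distribution function of the standard normal distribution (the Gaussian measure on ℝ with mean 0 and variance 1). For all real numbers a, b, v with v > 0 and |a| < |b|, one has Φ(b + v) − Φ(b − v) < Φ(a + v) − Φ(a − v). Equivalently, the standard normal probability of the interval [b − v, b + v] is strictly less than that of [a − v, a + v]. -/

import Mathlib

/-- Φ, the standard normal cumulative distribution function. -/
noncomputable def Phi (t : ℝ) : ℝ :=
  ((ProbabilityTheory.gaussianReal 0 1) (Set.Iic t)).toReal

open ProbabilityTheory MeasureTheory in
theorem Phi_sub_Phi (x y : ℝ) :
    Phi y - Phi x = ∫ t in x..y, gaussianPDFReal 0 1 t := by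
  have h (t : ℝ) : Phi t = ∫ s in Set.Iic t, gaussianPDFReal 0 1 s := by
    rw [Phi, gaussianReal_apply_eq_integral 0 one_ne_zero, ENNReal.toReal_ofReal]
    exact integral_nonneg fun s => gaussianPDFReal_nonneg 0 1 s
  rw [h, h]
  exact intervalIntegral.integral_Iic_sub_Iic
    (integrable_gaussianPDFReal 0 1).integrableOn (integrable_gaussianPDFReal 0 1).integrableOn

open ProbabilityTheory in
theorem continuous_gaussianPDFReal_zero_one : Continuous (gaussianPDFReal 0 1) := by
  unfold gaussianPDFReal
  fun_prop

open ProbabilityTheory in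
theorem hasDerivAt_Phi (x : ℝ) : HasDerivAt Phi (gaussianPDFReal 0 1 x) x := by
  have h : Phi = fun y => (∫ t in (0 : ℝ)..y, gaussianPDFReal 0 1 t) + Phi 0 := by
    funext y
    rw [← Phi_sub_Phi, sub_add_cancel]
  rw [h]
  exact (continuous_gaussianPDFReal_zero_one.integral_hasStrictDerivAt 0 x).hasDerivAt.add_const _

open ProbabilityTheory in
theorem gaussianPDFReal_zero_one_lt {x y : ℝ} (h : x ^ 2 < y ^ 2) :
    gaussianPDFReal 0 1 y < gaussianPDFReal 0 1 x := by
  simp only [gaussianPDFReal, sub_zero]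
  gcongr

open ProbabilityTheory in
theorem Phi_neg_add_sub_Phi_neg_sub (x v : ℝ) :
    Phi (-x + v) - Phi (-x - v) = Phi (x + v) - Phi (x - v) := by
  have h (t : ℝ) : gaussianPDFReal 0 1 (-t) = gaussianPDFReal 0 1 t := by
    simp [gaussianPDFReal]
  rw [Phi_sub_Phi, Phi_sub_Phi,
    show -x - v = -(x + v) by ring, show -x + v = -(x - v) by ring,
    ← intervalIntegral.integral_comp_neg]
  simp only [h]

theorem strictAntiOn_Phi_add_sub_Phi_sub {v : ℝ} (hv : 0 < v) :
    StrictAntiOn (fun x => Phi (x + v) - Phi (x - v)) (Set.Ici 0) := by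
  have hd (x : ℝ) := ((hasDerivAt_Phi (x + v)).comp_add_const x v).sub
    ((hasDerivAt_Phi (x - v)).comp_sub_const x v)
  refine strictAntiOn_of_deriv_neg (convex_Ici 0)
    (fun x _ => (hd x).continuousAt.continuousWithinAt) fun x hx => ?_
  rw [interior_Ici, Set.mem_Ioi] at hx
  refine (hd x).deriv.trans_lt (sub_neg.2 (gaussianPDFReal_zero_one_lt ?_))
  nlinarith [mul_pos hx hv]

/-- The standard normal probability of an interval of half-width v > 0 strictly
decreases as the center moves away from 0: if |a| < |b| then
Φ(b + v) − Φ(b − v) < Φ(a + v) − Φ(a − v). -/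
theorem gaussian_interval_prob_strict_anti (a b v : ℝ) (hv : 0 < v) (hab : |a| < |b|) :
    Phi (b + v) - Phi (b - v) < Phi (a + v) - Phi (a - v) := by
  have h (x : ℝ) : Phi (|x| + v) - Phi (|x| - v) = Phi (x + v) - Phi (x - v) := by
    rcases abs_choice x with hx | hx <;> rw [hx]
    exact Phi_neg_add_sub_Phi_neg_sub x v
  rw [← h a, ← h b]
  exact strictAntiOn_Phi_add_sub_Phi_sub hv (abs_nonneg a) (abs_nonneg b) hab
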